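/- (Ando–Shih) If the joint spectral radius of a finite set M of real n×n matrices satisfies ρ(M) < 1/√n, then M admits a common quadratic Lyapunov function: there exists a symmetric positive definite real n×n matrix Q such that AᵀQA − Q is negative definite for every A ∈ M. -/

import Mathlib

open Filter Matrix

/-- The operator norm on `n × n` real matrices induced by the Euclidean norm on `ℝ^n`. -/
noncomputable def euclOpNorm {n : ℕ} (A : Matrix (Fin n) (Fin n) ℝ) : ℝ :=
  ‖LinearMap.toContinuousLinearMap (Matrix.toEuclideanLin A)‖

/-- The Euclidean norm on `ℝ^n`. -/
noncomputable def euclNorm {n : ℕ} (x : Fin n → ℝ) : ℝ :=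
  Real.sqrt (∑ i, x i ^ 2)

/-- The matrix product `A_{σ(t-1)} ⋯ A_{σ(0)}` associated to a sequence of labels `σ`. -/
noncomputable def pathProd {n N : ℕ} (A : Fin N → Matrix (Fin n) (Fin n) ℝ)
    (t : ℕ) (σ : Fin t → Fin N) : Matrix (Fin n) (Fin n) ℝ :=
  (List.ofFn fun i => A (σ i)).reverse.prod

/-- `v, σ` describe a path of length `t` in the labeled graph with edge set `E`:
its `i`-th edge goes from node `v i` to node `v (i+1)` and carries the label `σ i`. -/
def IsPath {V : Type*} {N : ℕ} (E : Set (V × V × Fin N)) {t : ℕ}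
    (v : Fin (t + 1) → V) (σ : Fin t → Fin N) : Prop :=
  ∀ i : Fin t, (v i.castSucc, v i.succ, σ i) ∈ E

/-- The labeled graph with edge set `E` is strongly connected: any node can be joined to
any node by a path of length at least 1. -/
def StronglyConnected {V : Type*} {N : ℕ} (E : Set (V × V × Fin N)) : Prop :=
  ∀ u w : V, ∃ (t : ℕ) (v : Fin (t + 1) → V) (σ : Fin t → Fin N),
    1 ≤ t ∧ IsPath E v σ ∧ v 0 = u ∧ v (Fin.last t) = w

/-- The constrained joint spectral radius of the system `S(G, M)` with `G = (V, E)`, `M = A`. -/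
noncomputable def cjsr {V : Type*} {n N : ℕ} (E : Set (V × V × Fin N))
    (A : Fin N → Matrix (Fin n) (Fin n) ℝ) : ℝ :=
  Filter.atTop.limsup fun t : ℕ =>
    sSup { x : ℝ | ∃ (v : Fin (t + 1) → V) (σ : Fin t → Fin N),
      IsPath E v σ ∧ x = euclOpNorm (pathProd A t σ) ^ (1 / (t : ℝ)) }

/-- The constrained joint spectral radius of the `T`-lifted system `S(G_T, M^T)`:
paths of length `k` in `G_T` are exactly paths of length `k * T` in `G`. -/
noncomputable def cjsrLift {V : Type*} {n N : ℕ} (E : Set (V × V × Fin N))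
    (A : Fin N → Matrix (Fin n) (Fin n) ℝ) (T : ℕ) : ℝ :=
  Filter.atTop.limsup fun k : ℕ =>
    sSup { x : ℝ | ∃ (v : Fin (k * T + 1) → V) (σ : Fin (k * T) → Fin N),
      IsPath E v σ ∧ x = euclOpNorm (pathProd A (k * T) σ) ^ (1 / (k : ℝ)) }

/-- Stability of the constrained switching system: along every infinite path of the graph,
every trajectory converges to `0`. -/
def Stable {V : Type*} {n N : ℕ} (E : Set (V × V × Fin N))
    (A : Fin N → Matrix (Fin n) (Fin n) ℝ) : Prop :=
  ∀ (v : ℕ → V) (σ : ℕ → Fin N), (∀ t : ℕ, (v t, v (t + 1), σ t) ∈ E) →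
    ∀ x0 : Fin n → ℝ,
      Tendsto (fun t : ℕ => (pathProd A t fun i : Fin t => σ i).mulVec x0)
        atTop (nhds 0)

/-- `ν` is a family of norms on `ℝ^n` indexed by the nodes. -/
def IsNormFamily {V : Type*} {n : ℕ} (ν : V → (Fin n → ℝ) → ℝ) : Prop :=
  ∀ u : V,
    (∀ x y : Fin n → ℝ, ν u (x + y) ≤ ν u x + ν u y) ∧
    (∀ (a : ℝ) (x : Fin n → ℝ), ν u (a • x) = |a| * ν u x) ∧
    (∀ x : Fin n → ℝ, ν u x = 0 → x = 0)

/-- `ν` is a `γ`-multinorm for the system `S(G, M)`. -/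
def IsMultinorm {V : Type*} {n N : ℕ} (E : Set (V × V × Fin N))
    (A : Fin N → Matrix (Fin n) (Fin n) ℝ) (γ : ℝ)
    (ν : V → (Fin n → ℝ) → ℝ) : Prop :=
  IsNormFamily ν ∧
    ∀ vi vj : V, ∀ σ : Fin N, (vi, vj, σ) ∈ E →
      ∀ x : Fin n → ℝ, ν vj ((A σ).mulVec x) ≤ γ * ν vi x

/-- `Q` is a quadratic `γ`-multinorm for the system `S(G, M)`. -/
def IsQuadMultinorm {V : Type*} {n N : ℕ} (E : Set (V × V × Fin N))
    (A : Fin N → Matrix (Fin n) (Fin n) ℝ) (γ : ℝ)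
    (Q : V → Matrix (Fin n) (Fin n) ℝ) : Prop :=
  (∀ u : V, (Q u).PosDef) ∧
    ∀ vi vj : V, ∀ σ : Fin N, (vi, vj, σ) ∈ E →
      (γ ^ 2 • Q vi - (A σ)ᵀ * Q vj * A σ).PosSemidef

/-- `Q` is a quadratic `γ`-multinorm for the lifted system `S(G_T, M^T)`: the Loewner
inequality holds along every path of length `T` of `G` (i.e. every edge of `G_T`). -/
def IsQuadMultinormLift {V : Type*} {n N : ℕ} (E : Set (V × V × Fin N))
    (A : Fin N → Matrix (Fin n) (Fin n) ℝ) (T : ℕ) (γ : ℝ)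
    (Q : V → Matrix (Fin n) (Fin n) ℝ) : Prop :=
  (∀ u : V, (Q u).PosDef) ∧
    ∀ (v : Fin (T + 1) → V) (σ : Fin T → Fin N), IsPath E v σ →
      (γ ^ 2 • Q (v 0) -
        (pathProd A T σ)ᵀ * Q (v (Fin.last T)) * pathProd A T σ).PosSemidef

/-- `Q` is a path-dependent Lyapunov function with memory `T` for `S(G, M)`:
one positive definite quadratic form per path of length `T`, with a strict decrease
condition along every path of length `T + 1`. -/
def IsPathDepLyap {V : Type*} {n N : ℕ} (E : Set (V × V × Fin N))
    (A : Fin N → Matrix (Fin n) (Fin n) ℝ) (T : ℕ)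
    (Q : (Fin (T + 1) → V) → (Fin T → Fin N) → Matrix (Fin n) (Fin n) ℝ) : Prop :=
  (∀ (v : Fin (T + 1) → V) (σ : Fin T → Fin N), IsPath E v σ → (Q v σ).PosDef) ∧
    ∀ (v : Fin (T + 2) → V) (σ : Fin (T + 1) → Fin N), IsPath E v σ →
      (Q (fun i : Fin (T + 1) => v i.castSucc) (fun i : Fin T => σ i.castSucc) -
        (A (σ (Fin.last T)))ᵀ *
          Q (fun i : Fin (T + 1) => v i.succ) (fun i : Fin T => σ i.succ) *
            A (σ (Fin.last T))).PosDef

/-- The joint spectral radius of a finite set of matrices (arbitrary switching). -/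
noncomputable def jsr {n N : ℕ} (A : Fin N → Matrix (Fin n) (Fin n) ℝ) : ℝ :=
  Filter.atTop.limsup fun t : ℕ =>
    sSup { x : ℝ | ∃ σ : Fin t → Fin N,
      x = euclOpNorm (pathProd A t σ) ^ (1 / (t : ℝ)) }

/-- The joint spectral radius of the set `M^T` of all products of `T` matrices from `M`:
products of `k` matrices from `M^T` are exactly products of `k * T` matrices from `M`. -/
noncomputable def jsrPow {n N : ℕ} (A : Fin N → Matrix (Fin n) (Fin n) ℝ) (T : ℕ) : ℝ :=
  Filter.atTop.limsup fun k : ℕ =>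
    sSup { x : ℝ | ∃ σ : Fin (k * T) → Fin N,
      x = euclOpNorm (pathProd A (k * T) σ) ^ (1 / (k : ℝ)) }

/-- The optimal value `γ*(G, M)` of the semidefinite program of Corollary 4.6. -/
noncomputable def gammaStar {V : Type*} {n N : ℕ} (E : Set (V × V × Fin N))
    (A : Fin N → Matrix (Fin n) (Fin n) ℝ) : ℝ :=
  sInf {γ : ℝ | 0 < γ ∧ ∃ Q : V → Matrix (Fin n) (Fin n) ℝ,
    (∀ u : V, (Q u).PosDef) ∧ ∀ vi vj : V, ∀ σ : Fin N, (vi, vj, σ) ∈ E →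
      (γ ^ 2 • Q vi - (A σ)ᵀ * Q vj * A σ).PosDef}

/-- The optimal value `γ*(G_T, M^T)` of the semidefinite program applied to the lifted
system `S(G_T, M^T)`. -/
noncomputable def gammaStarLift {V : Type*} {n N : ℕ} (E : Set (V × V × Fin N))
    (A : Fin N → Matrix (Fin n) (Fin n) ℝ) (T : ℕ) : ℝ :=
  sInf {γ : ℝ | 0 < γ ∧ ∃ Q : V → Matrix (Fin n) (Fin n) ℝ,
    (∀ u : V, (Q u).PosDef) ∧
      ∀ (v : Fin (T + 1) → V) (σ : Fin T → Fin N), IsPath E v σ →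
        (γ ^ 2 • Q (v 0) -
          (pathProd A T σ)ᵀ * Q (v (Fin.last T)) * pathProd A T σ).PosDef}

/-- A first-order consequence of a polynomial inequality. -/
lemma le_of_one_add_mul_le_pow (n : ℕ) (c : ℝ)
    (h : ∀ r : ℝ, 0 < r → 1 + r * c ≤ (1 + r) ^ n) : c ≤ n := by
  have hd : HasDerivAt (fun r : ℝ => (1 + r) ^ n) (n : ℝ) 0 := by
    have := ((hasDerivAt_id (0 : ℝ)).const_add 1).pow n
    simp only [id, add_zero, one_pow, mul_one] at this
    exact this
  rw [hasDerivAt_iff_tendsto_slope] at hd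
  have hd' := hd.mono_left (nhdsWithin_mono (0 : ℝ) (s := Set.Ioi 0) (fun x hx => ne_of_gt hx))
  refine ge_of_tendsto hd' ?_
  filter_upwards [self_mem_nhdsWithin] with r hr
  have hr' : (0 : ℝ) < r := hr
  rw [slope_def_field, le_div_iff₀ (by simpa using hr')]
  have := h r hr'
  simp
  linarith

lemma det_rank_one {n : ℕ} (Q : Matrix (Fin n) (Fin n) ℝ) (hQ : IsUnit Q.det) (g : Fin n → ℝ)
    (r : ℝ) : (Q + r • vecMulVec g g).det = Q.det * (1 + r * (g ⬝ᵥ (Q⁻¹ *ᵥ g))) := by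
  have h := det_add_replicateCol_mul_replicateRow (ι := Unit) hQ (r • g) g
  have e : replicateCol Unit (r • g) * replicateRow Unit g = r • vecMulVec g g := by
    ext i j
    simp [Matrix.mul_apply, vecMulVec_apply, mul_assoc]
  rw [e] at h
  rw [h, Matrix.mul_assoc]
  congr 1
  rw [det_unique]
  simp only [Matrix.add_apply, Matrix.one_apply_eq]
  congr 1
  have : (replicateRow Unit g * (Q⁻¹ * replicateCol Unit (r • g))) default default
      = g ⬝ᵥ (Q⁻¹ *ᵥ (r • g)) := by
    simp only [Matrix.mul_apply, dotProduct, mulVec, replicateRow_apply, replicateCol_apply]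
  rw [this, mulVec_smul, dotProduct_smul, smul_eq_mul]

/-- Cauchy-Schwarz for a symmetric nonnegative form. -/
lemma form_cauchy {n : ℕ} (Q : Matrix (Fin n) (Fin n) ℝ) (hs : Qᵀ = Q)
    (hp : ∀ x, 0 ≤ x ⬝ᵥ (Q *ᵥ x)) (z x : Fin n → ℝ) :
    (z ⬝ᵥ (Q *ᵥ x)) ^ 2 ≤ (z ⬝ᵥ (Q *ᵥ z)) * (x ⬝ᵥ (Q *ᵥ x)) := by
  have hsym : x ⬝ᵥ (Q *ᵥ z) = z ⬝ᵥ (Q *ᵥ x) := by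
    rw [dotProduct_mulVec, ← mulVec_transpose, hs, dotProduct_comm]
  have key : ∀ t : ℝ, 0 ≤ (z ⬝ᵥ (Q *ᵥ z)) * (t * t) + (2 * (z ⬝ᵥ (Q *ᵥ x))) * t
      + (x ⬝ᵥ (Q *ᵥ x)) := by
    intro t
    have := hp (x + t • z)
    simp only [mulVec_add, mulVec_smul, dotProduct_add, add_dotProduct, smul_dotProduct,
      dotProduct_smul, smul_eq_mul, hsym] at this
    linarith
  have := discrim_le_zero key
  unfold discrim at this
  linarith

/-- Loewner ellipsoid theorem in functional form. -/
lemma loewner {n : ℕ} (w : (Fin n → ℝ) → ℝ) (M : ℝ)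
    (hM : ∀ x, w x ≤ M * (x ⬝ᵥ x)) (h1 : ∀ x, x ⬝ᵥ x ≤ w x) :
    ∃ Q : Matrix (Fin n) (Fin n) ℝ, Q.PosDef ∧ (∀ x, x ⬝ᵥ (Q *ᵥ x) ≤ w x) ∧
      ∀ g : Fin n → ℝ, (∀ x, (g ⬝ᵥ x) ^ 2 ≤ w x) → ∀ x, (g ⬝ᵥ x) ^ 2 ≤ n * (x ⬝ᵥ (Q *ᵥ x)) := by
  let C : Set (Matrix (Fin n) (Fin n) ℝ) :=
    {Q | Qᵀ = Q ∧ ∀ x, 0 ≤ x ⬝ᵥ (Q *ᵥ x) ∧ x ⬝ᵥ (Q *ᵥ x) ≤ w x}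
  have hclosed : IsClosed C := by
    have hc : ∀ x : Fin n → ℝ, Continuous
        (fun Q : Matrix (Fin n) (Fin n) ℝ => x ⬝ᵥ (Q *ᵥ x)) := by
      intro x; fun_prop
    have e : C = {Q | Qᵀ = Q} ∩ ⋂ x, {Q | 0 ≤ x ⬝ᵥ (Q *ᵥ x)} ∩ {Q | x ⬝ᵥ (Q *ᵥ x) ≤ w x} := by
      ext Q; simp [C]
    rw [e]
    refine (isClosed_eq (by fun_prop) (by fun_prop)).inter (isClosed_iInter fun x => ?_)
    exact (isClosed_le continuous_const (hc x)).inter (isClosed_le (hc x) continuous_const)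
  have hcomp : IsCompact C := by
    have hK : IsCompact (Set.pi Set.univ fun _ : Fin n => Set.pi Set.univ
        fun _ : Fin n => Set.Icc (-M) M) :=
      isCompact_univ_pi fun _ => isCompact_univ_pi fun _ => isCompact_Icc
    refine IsCompact.of_isClosed_subset hK hclosed ?_
    rintro Q ⟨hs, hx⟩ i - j -
    have hii : ∀ i, Q i i ≤ M := fun i => by
      have := ((hx (Pi.single i 1)).2).trans (hM _)
      simpa using this
    have hij : Q j i = Q i j := congrFun (congrFun hs i) j
    have hp := (hx (Pi.single i 1 + Pi.single j 1)).1
    have hm := (hx (Pi.single i 1 - Pi.single j 1)).1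
    have e1 := hii i
    have e2 := hii j
    simp [mulVec_add, mulVec_sub, dotProduct_add, add_dotProduct, hij] at hp hm
    constructor <;> linarith
  have h1C : (1 : Matrix (Fin n) (Fin n) ℝ) ∈ C := by
    refine ⟨by simp, fun x => ⟨?_, ?_⟩⟩
    · rw [one_mulVec]
      exact Finset.sum_nonneg fun i _ => mul_self_nonneg (x i)
    · simpa using h1 x
  obtain ⟨Q, hQC, hmax⟩ := hcomp.exists_isMaxOn ⟨1, h1C⟩
    (f := fun Q : Matrix (Fin n) (Fin n) ℝ => Q.det) (by fun_prop)
  have hdet : 1 ≤ Q.det := by simpa using hmax h1C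
  have hpos : 0 < Q.det := by linarith
  have hpsd : Q.PosSemidef := PosSemidef.of_dotProduct_mulVec_nonneg
    (by simpa [IsHermitian, conjTranspose_eq_transpose_of_trivial] using hQC.1)
    (fun x => by simpa using (hQC.2 x).1)
  refine ⟨Q, hpsd.posDef_iff_det_ne_zero.2 hpos.ne', fun x => (hQC.2 x).2, ?_⟩
  intro g hg x
  have hu : IsUnit Q.det := isUnit_iff_ne_zero.2 hpos.ne'
  set z := Q⁻¹ *ᵥ g with hz
  have hQz : Q *ᵥ z = g := by
    rw [hz, mulVec_mulVec, mul_nonsing_inv _ hu, one_mulVec]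
  have hgx : ∀ x, z ⬝ᵥ (Q *ᵥ x) = g ⬝ᵥ x := fun x => by
    rw [dotProduct_mulVec, ← mulVec_transpose, hQC.1, hQz]
  have hcs := form_cauchy Q hQC.1 (fun x => (hQC.2 x).1) z x
  rw [hgx, hgx] at hcs
  refine hcs.trans (mul_le_mul_of_nonneg_right ?_ (hQC.2 x).1)
  refine le_of_one_add_mul_le_pow n _ fun r hr => ?_
  have hr1 : 0 < 1 + r := by linarith
  have hmem : (1 + r)⁻¹ • (Q + r • vecMulVec g g) ∈ C := by
    refine ⟨?_, fun y => ?_⟩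
    · rw [transpose_smul, transpose_add, transpose_smul, hQC.1, transpose_vecMulVec]
    · have e : y ⬝ᵥ (((1 + r)⁻¹ • (Q + r • vecMulVec g g)) *ᵥ y)
          = (1 + r)⁻¹ * (y ⬝ᵥ (Q *ᵥ y) + r * (g ⬝ᵥ y) ^ 2) := by
        simp only [smul_mulVec, add_mulVec, vecMulVec_mulVec, dotProduct_smul, dotProduct_add,
          smul_eq_mul, op_smul_eq_smul, dotProduct_comm y g]
        ring
      rw [e]
      have h0 := hQC.2 y
      have hgy := hg y
      constructor
      · have := h0.1
        positivity
      · rw [inv_mul_le_iff₀ hr1]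
        nlinarith [h0.2]
  have hle := hmax hmem
  simp only [Set.mem_ofPred_eq, det_smul, Fintype.card_fin, det_rank_one Q hu] at hle
  rw [inv_pow, inv_mul_le_iff₀ (by positivity)] at hle
  rw [← hz] at hle
  nlinarith

lemma dot_mulVec_le {n : ℕ} (P : Matrix (Fin n) (Fin n) ℝ) (x : Fin n → ℝ) :
    (P *ᵥ x) ⬝ᵥ (P *ᵥ x) ≤ euclOpNorm P ^ 2 * (x ⬝ᵥ x) := by
  have h := (LinearMap.toContinuousLinearMap (Matrix.toEuclideanLin P)).le_opNorm (WithLp.toLp 2 x)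
  have h2 := pow_le_pow_left₀ (norm_nonneg _) h 2
  rw [mul_pow, EuclideanSpace.real_norm_sq_eq, EuclideanSpace.real_norm_sq_eq] at h2
  simpa [dotProduct, ← pow_two, euclOpNorm] using h2

lemma euclOpNorm_nonneg {n : ℕ} (P : Matrix (Fin n) (Fin n) ℝ) : 0 ≤ euclOpNorm P := norm_nonneg _

lemma euclOpNorm_mul_le {n : ℕ} (P R : Matrix (Fin n) (Fin n) ℝ) :
    euclOpNorm (P * R) ≤ euclOpNorm P * euclOpNorm R := by
  unfold euclOpNorm
  have : LinearMap.toContinuousLinearMap (Matrix.toEuclideanLin (P * R))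
      = (LinearMap.toContinuousLinearMap (Matrix.toEuclideanLin P)).comp
        (LinearMap.toContinuousLinearMap (Matrix.toEuclideanLin R)) := by
    ext x
    simp [Matrix.toLpLin_apply]
  rw [this]
  exact ContinuousLinearMap.opNorm_comp_le _ _

lemma euclOpNorm_one_le {n : ℕ} : euclOpNorm (1 : Matrix (Fin n) (Fin n) ℝ) ≤ 1 := by
  unfold euclOpNorm
  refine ContinuousLinearMap.opNorm_le_bound _ zero_le_one fun x => ?_
  simp [Matrix.toLpLin_apply]

lemma euclOpNorm_list_le {n N : ℕ} (A : Fin N → Matrix (Fin n) (Fin n) ℝ) (K : ℝ) (hK : 0 ≤ K)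
    (hA : ∀ i, euclOpNorm (A i) ≤ K) (l : List (Fin N)) :
    euclOpNorm (l.map A).prod ≤ K ^ l.length := by
  induction l with
  | nil => simpa using euclOpNorm_one_le
  | cons a l ih =>
    simp only [List.map_cons, List.prod_cons, List.length_cons, pow_succ']
    exact (euclOpNorm_mul_le _ _).trans
      (mul_le_mul (hA a) ih (euclOpNorm_nonneg _) hK)

lemma pathProd_eq {n N : ℕ} (A : Fin N → Matrix (Fin n) (Fin n) ℝ) (t : ℕ) (σ : Fin t → Fin N) :
    pathProd A t σ = ((List.ofFn σ).reverse.map A).prod := by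
  unfold pathProd
  rw [List.map_reverse, List.map_ofFn]
  rfl

lemma exists_pathProd {n N : ℕ} (A : Fin N → Matrix (Fin n) (Fin n) ℝ) (l : List (Fin N)) :
    ∃ σ : Fin l.length → Fin N, pathProd A l.length σ = (l.map A).prod := by
  have key : ∀ m : List (Fin N), ∀ t, m.length = t → ∃ σ : Fin t → Fin N, List.ofFn σ = m := by
    rintro m t rfl
    exact ⟨m.get, List.ofFn_get m⟩
  obtain ⟨σ, hσ⟩ := key l.reverse l.length (by simp)
  exact ⟨σ, by rw [pathProd_eq, hσ, List.reverse_reverse]⟩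

lemma jsr_bound {n N : ℕ} (A : Fin N → Matrix (Fin n) (Fin n) ℝ) (γ : ℝ) (hγ : 0 < γ)
    (h : jsr A < γ) :
    ∃ M : ℝ, ∀ l : List (Fin N), euclOpNorm (l.map A).prod ≤ M * γ ^ l.length := by
  obtain ⟨K, hK0, hK⟩ : ∃ K : ℝ, 1 ≤ K ∧ ∀ i, euclOpNorm (A i) ≤ K := by
    refine ⟨1 + ∑ i, euclOpNorm (A i), ?_, fun i => ?_⟩
    · have : 0 ≤ ∑ i, euclOpNorm (A i) := Finset.sum_nonneg fun i _ => euclOpNorm_nonneg _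
      linarith
    · have := Finset.single_le_sum (f := fun i => euclOpNorm (A i))
        (fun i _ => euclOpNorm_nonneg _) (Finset.mem_univ i)
      linarith
  have hK' : 0 ≤ K := by linarith
  have hub : ∀ t : ℕ, ∀ x ∈ { x : ℝ | ∃ σ : Fin t → Fin N,
      x = euclOpNorm (pathProd A t σ) ^ (1 / (t : ℝ)) }, x ≤ K := by
    rintro t x ⟨σ, rfl⟩
    rcases Nat.eq_zero_or_pos t with rfl | ht
    · simpa using hK0
    · have h1 : euclOpNorm (pathProd A t σ) ≤ K ^ t := by
        rw [pathProd_eq]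
        simpa using euclOpNorm_list_le A K hK' hK (List.ofFn σ).reverse
      calc euclOpNorm (pathProd A t σ) ^ (1 / (t : ℝ)) ≤ (K ^ t) ^ (1 / (t : ℝ)) :=
            Real.rpow_le_rpow (euclOpNorm_nonneg _) h1 (by positivity)
        _ = K := by
            rw [one_div]
            exact Real.pow_rpow_inv_natCast hK' ht.ne'
  have hev := Filter.eventually_lt_of_limsup_lt h
    (Filter.isBoundedUnder_of ⟨K, fun t => Real.sSup_le (hub t) hK'⟩)
  obtain ⟨T, hT⟩ := Filter.eventually_atTop.1 hev
  have hbig : ∀ l : List (Fin N), T ≤ l.length → 1 ≤ l.length →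
      euclOpNorm (l.map A).prod ≤ γ ^ l.length := by
    intro l hl hl1
    obtain ⟨σ, hσ⟩ := exists_pathProd A l
    have h1 := le_csSup ⟨K, hub l.length⟩ ⟨σ, rfl⟩
    have h2 := (h1.trans_lt (hT l.length hl)).le
    rw [hσ] at h2
    have h3 := pow_le_pow_left₀ (Real.rpow_nonneg (euclOpNorm_nonneg _) _) h2 l.length
    rwa [one_div, Real.rpow_inv_natCast_pow (euclOpNorm_nonneg _) (by omega)] at h3
  refine ⟨(max 1 (K / γ)) ^ (T + 1), fun l => ?_⟩
  have hm : (1 : ℝ) ≤ max 1 (K / γ) := le_max_left _ _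
  by_cases hl : T + 1 ≤ l.length
  · refine (hbig l (by omega) (by omega)).trans ?_
    exact le_mul_of_one_le_left (by positivity) (one_le_pow₀ hm)
  · refine (euclOpNorm_list_le A K hK' hK l).trans ?_
    have : K ^ l.length = (K / γ) ^ l.length * γ ^ l.length := by
      rw [← mul_pow, div_mul_cancel₀ _ hγ.ne']
    rw [this]
    gcongr
    calc (K / γ) ^ l.length ≤ (max 1 (K / γ)) ^ l.length :=
          pow_le_pow_left₀ (by positivity) (le_max_right _ _) _
      _ ≤ _ := pow_le_pow_right₀ hm (by omega)

/-- Ando–Shih: if `ρ(M) < 1/√n` then `M` admits a common quadratic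
Lyapunov function. -/
theorem ando_shih {n N : ℕ} (hn : 1 ≤ n) (hN : 1 ≤ N)
    (A : Fin N → Matrix (Fin n) (Fin n) ℝ)
    (hρ : jsr A < 1 / Real.sqrt n) :
    ∃ Q : Matrix (Fin n) (Fin n) ℝ, Q.PosDef ∧
      ∀ i : Fin N, (Q - (A i)ᵀ * Q * A i).PosDef := by
  have hn0 : (0 : ℝ) < n := by exact_mod_cast hn
  obtain ⟨γ, hγ1, hγ2⟩ := exists_between (max_lt hρ (show 0 < 1 / Real.sqrt n by positivity))
  have hγ : 0 < γ := (le_max_right _ _).trans_lt hγ1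
  have hγn : γ ^ 2 * n < 1 := by
    have h := pow_lt_pow_left₀ hγ2 hγ.le two_ne_zero
    rw [div_pow, Real.sq_sqrt hn0.le, one_pow, lt_div_iff₀ hn0] at h
    exact h
  obtain ⟨M, hM⟩ := jsr_bound A γ hγ ((le_max_left _ _).trans_lt hγ1)
  let F : List (Fin N) → (Fin n → ℝ) → ℝ := fun l x =>
    ((γ ^ l.length) ^ 2)⁻¹ * (((l.map A).prod *ᵥ x) ⬝ᵥ ((l.map A).prod *ᵥ x))
  have hdot : ∀ x : Fin n → ℝ, 0 ≤ x ⬝ᵥ x := fun x => by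
    exact Finset.sum_nonneg fun i _ => mul_self_nonneg (x i)
  have hF : ∀ l x, F l x ≤ M ^ 2 * (x ⬝ᵥ x) := by
    intro l x
    simp only [F]
    rw [inv_mul_le_iff₀ (by positivity)]
    refine (dot_mulVec_le _ x).trans ?_
    rw [← mul_assoc, ← mul_pow, mul_comm _ M]
    exact mul_le_mul_of_nonneg_right (pow_le_pow_left₀ (euclOpNorm_nonneg _) (hM l) 2) (hdot x)
  have hbdd : ∀ x, BddAbove (Set.range fun l => F l x) := fun x =>
    ⟨M ^ 2 * (x ⬝ᵥ x), by rintro _ ⟨l, rfl⟩; exact hF l x⟩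
  let w : (Fin n → ℝ) → ℝ := fun x => ⨆ l, F l x
  have hle : ∀ l x, F l x ≤ w x := fun l x => le_ciSup (hbdd x) l
  obtain ⟨Q, hQ, hQw, hQg⟩ := loewner w (M ^ 2) (fun x => ciSup_le fun l => hF l x)
    (fun x => by simpa [F] using hle [] x)
  have hQs : Qᵀ = Q := by
    simpa [IsHermitian, conjTranspose_eq_transpose_of_trivial] using hQ.1
  have hwQ : ∀ x, w x ≤ n * (x ⬝ᵥ (Q *ᵥ x)) := by
    intro x
    refine ciSup_le fun l => ?_
    set P := (l.map A).prod with hP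
    set s := (γ ^ l.length)⁻¹ with hs
    set y := P *ᵥ x with hy
    have hFl : ∀ x, F l x = s ^ 2 * ((P *ᵥ x) ⬝ᵥ (P *ᵥ x)) := fun x => by
      simp only [F, hs, inv_pow, hP]
    have hxQ : 0 ≤ x ⬝ᵥ (Q *ᵥ x) := by
      simpa using hQ.posSemidef.dotProduct_mulVec_nonneg x
    rcases (hdot y).eq_or_lt with h0 | h0
    · rw [hFl, ← hy, ← h0, mul_zero]
      positivity
    set k := s / Real.sqrt (y ⬝ᵥ y) with hk
    have hk2 : k ^ 2 = s ^ 2 / (y ⬝ᵥ y) := by rw [hk, div_pow, Real.sq_sqrt h0.le]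
    have hgd : ∀ v, (k • (y ᵥ* P)) ⬝ᵥ v = k * (y ⬝ᵥ (P *ᵥ v)) := fun v => by
      rw [smul_dotProduct, ← dotProduct_mulVec, smul_eq_mul]
    have h := hQg (k • (y ᵥ* P)) (fun v => by
      refine le_trans ?_ (hle l v)
      rw [hFl, hgd, mul_pow, hk2]
      have cs : (y ⬝ᵥ (P *ᵥ v)) ^ 2 ≤ (y ⬝ᵥ y) * ((P *ᵥ v) ⬝ᵥ (P *ᵥ v)) := by
        have := Finset.sum_mul_sq_le_sq_mul_sq Finset.univ y (P *ᵥ v)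
        simpa [dotProduct, pow_two] using this
      rw [div_mul_eq_mul_div, div_le_iff₀ h0]
      nlinarith [sq_nonneg s, mul_le_mul_of_nonneg_left cs (sq_nonneg s)]) x
    rw [hgd, mul_pow, hk2, ← hy] at h
    rw [hFl, ← hy]
    have e : ∀ a b : ℝ, 0 < b → a / b * b ^ 2 = a * b := fun a b hb => by
      field_simp
    rw [e _ _ h0] at h
    exact h
  have hwA : ∀ i x, w (A i *ᵥ x) ≤ γ ^ 2 * w x := by
    intro i x
    refine ciSup_le fun l => ?_
    have h := hle (l ++ [i]) x
    have e : F (l ++ [i]) x = (γ ^ 2)⁻¹ * F l (A i *ᵥ x) := by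
      simp only [F, List.map_append, List.prod_append, List.map_cons, List.map_nil,
        List.prod_singleton, mulVec_mulVec, List.length_append, List.length_singleton]
      rw [pow_succ γ, mul_pow, mul_inv]
      ring
    rw [e, inv_mul_le_iff₀ (by positivity)] at h
    exact h
  refine ⟨Q, hQ, fun i => PosDef.of_dotProduct_mulVec_pos ?_ fun x hx => ?_⟩
  · rw [IsHermitian, conjTranspose_eq_transpose_of_trivial]
    simp [transpose_mul, hQs, Matrix.mul_assoc]
  · have hxQ : 0 < x ⬝ᵥ (Q *ᵥ x) := by
      simpa using hQ.dotProduct_mulVec_pos hx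
    have e : x ⬝ᵥ (((A i)ᵀ * Q * A i) *ᵥ x) = (A i *ᵥ x) ⬝ᵥ (Q *ᵥ (A i *ᵥ x)) := by
      rw [← mulVec_mulVec, ← mulVec_mulVec, dotProduct_mulVec x, vecMul_transpose]
    rw [star_trivial, sub_mulVec, dotProduct_sub, e]
    have h1 := hQw (A i *ᵥ x)
    have h2 := hwA i x
    have h3 := mul_le_mul_of_nonneg_left (hwQ x) (sq_nonneg γ)
    nlinarith
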